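/- Let 𝔰𝔎_r be the unital associative ℂ-algebra generated by S₀, S₃, S₊, S₋ subject to the relations [S₀,S₋] = −2{S₋,S₋}, [S₀,S₊] = 16{S₃,S₋} − 16{S₋,S₋} + 2{S₊,S₋} − 4{S₃,S₃}, [S₊,S₋] = 2{S₀,S₃}, [S₀,S₃] = 2{S₃,S₋} − 8{S₋,S₋}, [S₃,S₊] = {S₀,S₊}, [S₃,S₋] = −{S₀,S₋}, and let 𝔄 be the unital associative ℂ-algebra generated by U, V, Y, R subject to the relations [V,Y] = −{U,Y}, [U,Y] = −{Y,Y}, [U,V] = {V,Y} − 2{Y,Y}, [R,Y] = {U,U} − {U,V} + {V,Y}, [R,V] = 2{V,Y} − {Y,Y} − {V,V} − {U,R}, [R,U] = {U,V} + 2{V,Y} − 2{U,Y} − {V,V} − {Y,Y} − {R,Y}. Then the assignment S₀ ↦ 4Y − 4U, S₃ ↦ 4U − 2Y − 4V, S₊ ↦ 16R − 14Y − 8U + 24V, S₋ ↦ −2Y extends to an isomorphism of unital ℂ-algebras 𝔰𝔎_r ≅ 𝔄. -/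

import Mathlib

noncomputable section

/-- The free algebra on the four generators U, V, Y, R. -/
abbrev FreeStab := FreeAlgebra ℂ (Fin 4)

namespace StabStar

def U : FreeStab := FreeAlgebra.ι ℂ 0
def V : FreeStab := FreeAlgebra.ι ℂ 1
def Y : FreeStab := FreeAlgebra.ι ℂ 2
def R : FreeStab := FreeAlgebra.ι ℂ 3

/-- Commutator [a,b] = ab − ba. -/
def com (a b : FreeStab) : FreeStab := a * b - b * a

/-- Anticommutator {a,b} = ab + ba. -/
def acom (a b : FreeStab) : FreeStab := a * b + b * a

/-- The six defining relations of the universal presentation 𝔄 of 𝔰𝔱𝔞𝔟*. -/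
inductive Rel : FreeStab → FreeStab → Prop
  | r1 : Rel (com V Y) (-(acom U Y))
  | r2 : Rel (com U Y) (-(acom Y Y))
  | r3 : Rel (com U V) (acom V Y - 2 * acom Y Y)
  | r4 : Rel (com R Y) (acom U U - acom U V + acom V Y)
  | r5 : Rel (com R V) (2 * acom V Y - acom Y Y - acom V V - acom U R)
  | r6 : Rel (com R U)
      (acom U V + 2 * acom V Y - 2 * acom U Y - acom V V - acom Y Y - acom R Y)

end StabStar

/-- The universal presentation 𝔄 of the algebra 𝔰𝔱𝔞𝔟*. -/
abbrev StabStarAlg := RingQuot StabStar.Rel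

/-- The free algebra on the four generators S₀, S₃, S₊, S₋. -/
abbrev FreeSk := FreeAlgebra ℂ (Fin 4)

namespace Sk

def S0 : FreeSk := FreeAlgebra.ι ℂ 0
def S3 : FreeSk := FreeAlgebra.ι ℂ 1
def Sp : FreeSk := FreeAlgebra.ι ℂ 2
def Sm : FreeSk := FreeAlgebra.ι ℂ 3

/-- Commutator [a,b] = ab − ba. -/
def com (a b : FreeSk) : FreeSk := a * b - b * a

/-- Anticommutator {a,b} = ab + ba. -/
def acom (a b : FreeSk) : FreeSk := a * b + b * a

/-- The six defining relations of the rational degenerate Sklyanin algebra. -/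
inductive Rel : FreeSk → FreeSk → Prop
  | r1 : Rel (com S0 Sm) (-(2 * acom Sm Sm))
  | r2 : Rel (com S0 Sp)
      (16 * acom S3 Sm - 16 * acom Sm Sm + 2 * acom Sp Sm - 4 * acom S3 S3)
  | r3 : Rel (com Sp Sm) (2 * acom S0 S3)
  | r4 : Rel (com S0 S3) (2 * acom S3 Sm - 8 * acom Sm Sm)
  | r5 : Rel (com S3 Sp) (acom S0 Sp)
  | r6 : Rel (com S3 Sm) (-(acom S0 Sm))

end Sk

/-- The rational degenerate Sklyanin algebra 𝔰𝔎_r. -/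
abbrev SklyaninR := RingQuot Sk.Rel

namespace StabStar

theorem ofNat_mul_eq_smul {A : Type*} [Ring A] [Algebra ℂ A] (n : ℕ) [n.AtLeastTwo] (a : A) :
    (ofNat(n) : A) * a = (ofNat(n) : ℂ) • a := by
  rw [Algebra.smul_def, map_ofNat]

theorem neg_ofNat_mul_eq_smul {A : Type*} [Ring A] [Algebra ℂ A] (n : ℕ) [n.AtLeastTwo] (a : A) :
    (-ofNat(n) : A) * a = (-ofNat(n) : ℂ) • a := by
  rw [neg_mul, neg_smul, ofNat_mul_eq_smul]

/-- The homomorphism `𝔰𝔎_r → 𝔄` given on generators by `S₀ ↦ 4Y − 4U`, `S₃ ↦ 4U − 2Y − 4V`,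
`S₊ ↦ 16R − 14Y − 8U + 24V`, `S₋ ↦ −2Y`. -/
def ofSklyanin : SklyaninR →ₐ[ℂ] StabStarAlg :=
  RingQuot.liftAlgHom ℂ ⟨FreeAlgebra.lift ℂ
    (let m := RingQuot.mkAlgHom ℂ Rel
     ![4 * m Y - 4 * m U, 4 * m U - 2 * m Y - 4 * m V,
      16 * m R - 14 * m Y - 8 * m U + 24 * m V, (-2 : ℂ) • m Y]), by
    have h1 := RingQuot.mkAlgHom_rel ℂ Rel.r1
    have h2 := RingQuot.mkAlgHom_rel ℂ Rel.r2
    have h3 := RingQuot.mkAlgHom_rel ℂ Rel.r3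
    have h4 := RingQuot.mkAlgHom_rel ℂ Rel.r4
    have h5 := RingQuot.mkAlgHom_rel ℂ Rel.r5
    have h6 := RingQuot.mkAlgHom_rel ℂ Rel.r6
    simp only [com, acom, map_add, map_sub, map_mul, map_neg, map_smul,
      ofNat_mul_eq_smul] at h1 h2 h3 h4 h5 h6
    intro x y h
    cases h <;>
      simp only [Sk.com, Sk.acom, Sk.S0, Sk.S3, Sk.Sp, Sk.Sm, map_add, map_sub, map_mul, map_neg,
        FreeAlgebra.lift_ι_apply, Matrix.cons_val, map_smul, ofNat_mul_eq_smul,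
        mul_add, add_mul, mul_sub, sub_mul, smul_mul_assoc, mul_smul_comm]
    · linear_combination (norm := module) (8 : ℂ) • h2
    · linear_combination (norm := module)
        -(96 : ℂ) • h1 + (88 : ℂ) • h2 - (96 : ℂ) • h3 - (64 : ℂ) • h4 + (64 : ℂ) • h6
    · linear_combination (norm := module) -(48 : ℂ) • h1 + (16 : ℂ) • h2 - (32 : ℂ) • h4
    · linear_combination (norm := module) (16 : ℂ) • h1 - (8 : ℂ) • h2 + (16 : ℂ) • h3
    · linear_combination (norm := module)
        (104 : ℂ) • h1 - (72 : ℂ) • h2 + (64 : ℂ) • h3 + (32 : ℂ) • h4 + (64 : ℂ) • h5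
          - (64 : ℂ) • h6
    · linear_combination (norm := module) (8 : ℂ) • h1 - (8 : ℂ) • h2⟩

/-- The homomorphism `𝔄 → 𝔰𝔎_r` given on generators by the substitution inverse to that of
`ofSklyanin`. -/
def toSklyanin : StabStarAlg →ₐ[ℂ] SklyaninR :=
  RingQuot.liftAlgHom ℂ ⟨FreeAlgebra.lift ℂ
    (let m := RingQuot.mkAlgHom ℂ Sk.Rel
     ![(-1 / 4 : ℂ) • m Sk.S0 + (-1 / 2 : ℂ) • m Sk.Sm,
      (-1 / 4 : ℂ) • m Sk.S0 + (-1 / 4 : ℂ) • m Sk.S3 + (-1 / 4 : ℂ) • m Sk.Sm,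
      (-1 / 2 : ℂ) • m Sk.Sm,
      (1 / 4 : ℂ) • m Sk.S0 + (3 / 8 : ℂ) • m Sk.S3 + (1 / 16 : ℂ) • m Sk.Sp
        + (-5 / 16 : ℂ) • m Sk.Sm]), by
    have h1 := RingQuot.mkAlgHom_rel ℂ Sk.Rel.r1
    have h2 := RingQuot.mkAlgHom_rel ℂ Sk.Rel.r2
    have h3 := RingQuot.mkAlgHom_rel ℂ Sk.Rel.r3
    have h4 := RingQuot.mkAlgHom_rel ℂ Sk.Rel.r4
    have h5 := RingQuot.mkAlgHom_rel ℂ Sk.Rel.r5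
    have h6 := RingQuot.mkAlgHom_rel ℂ Sk.Rel.r6
    simp only [Sk.com, Sk.acom, map_add, map_sub, map_mul, map_neg, map_smul, ofNat_mul_eq_smul]
      at h1 h2 h3 h4 h5 h6
    intro x y h
    cases h <;>
      simp only [com, acom, U, V, Y, R, map_add, map_sub, map_mul, map_neg,
        FreeAlgebra.lift_ι_apply, Matrix.cons_val, map_smul, ofNat_mul_eq_smul,
        mul_add, add_mul, smul_mul_assoc, mul_smul_comm]
    · linear_combination (norm := module) (1 / 8 : ℂ) • h1 + (1 / 8 : ℂ) • h6
    · linear_combination (norm := module) (1 / 8 : ℂ) • h1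
    · linear_combination (norm := module)
        (-1 / 16 : ℂ) • h1 + (1 / 16 : ℂ) • h4 - (1 / 8 : ℂ) • h6
    · linear_combination (norm := module)
        (-1 / 8 : ℂ) • h1 - (1 / 32 : ℂ) • h3 - (3 / 16 : ℂ) • h6
    · linear_combination (norm := module)
        (-9 / 64 : ℂ) • h1 + (1 / 64 : ℂ) • h2 - (1 / 64 : ℂ) • h3 + (1 / 32 : ℂ) • h4
          + (1 / 64 : ℂ) • h5 - (11 / 64 : ℂ) • h6
    · linear_combination (norm := module)
        (-13 / 64 : ℂ) • h1 + (1 / 64 : ℂ) • h2 - (1 / 32 : ℂ) • h3 + (3 / 32 : ℂ) • h4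
          - (3 / 16 : ℂ) • h6⟩

theorem ofSklyanin_comp_toSklyanin : ofSklyanin.comp toSklyanin = AlgHom.id ℂ StabStarAlg := by
  apply RingQuot.ringQuot_ext'
  ext i
  fin_cases i <;>
    simp [ofSklyanin, toSklyanin, Sk.S0, Sk.S3, Sk.Sp, Sk.Sm, U, V, Y, R, ofNat_mul_eq_smul] <;>
    module

theorem toSklyanin_comp_ofSklyanin : toSklyanin.comp ofSklyanin = AlgHom.id ℂ SklyaninR := by
  apply RingQuot.ringQuot_ext'
  ext i
  fin_cases i <;>
    simp [ofSklyanin, toSklyanin, Sk.S0, Sk.S3, Sk.Sp, Sk.Sm, U, V, Y, R, ofNat_mul_eq_smul] <;>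
    module

end StabStar

/-- the assignment S₀ ↦ 4Y − 4U, S₃ ↦ 4U − 2Y − 4V,
S₊ ↦ 16R − 14Y − 8U + 24V, S₋ ↦ −2Y extends to an isomorphism of unital
ℂ-algebras 𝔰𝔎_r ≅ 𝔄. -/
theorem stmt18 :
    let mS := RingQuot.mkAlgHom ℂ Sk.Rel
    let mA := RingQuot.mkAlgHom ℂ StabStar.Rel
    let u := mA StabStar.U; let v := mA StabStar.V
    let y := mA StabStar.Y; let r := mA StabStar.R
    ∃ φ : SklyaninR ≃ₐ[ℂ] StabStarAlg,
      φ (mS Sk.S0) = 4 * y - 4 * u ∧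
      φ (mS Sk.S3) = 4 * u - 2 * y - 4 * v ∧
      φ (mS Sk.Sp) = 16 * r - 14 * y - 8 * u + 24 * v ∧
      φ (mS Sk.Sm) = -2 * y := by
  refine ⟨AlgEquiv.ofAlgHom StabStar.ofSklyanin StabStar.toSklyanin
    StabStar.ofSklyanin_comp_toSklyanin StabStar.toSklyanin_comp_ofSklyanin, ?_, ?_, ?_, ?_⟩ <;>
    simp [StabStar.ofSklyanin, Sk.S0, Sk.S3, Sk.Sp, Sk.Sm, StabStar.neg_ofNat_mul_eq_smul]
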